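/- Let F be a field of characteristic different from 2 in which 2 has a square root, and let G_1, …, G_t be finite simple bipartite graphs with bipartitions (X_i, Y_i) such that |X_i| ≤ |Y_i| for each i and the sets Y_1, …, Y_t are pairwise disjoint. Suppose that for each i there exist two weighted bi-adjacency matrices B_i and C_i of G_i over F (rows indexed by X_i, columns by Y_i) with B_i·C_iᵀ = I_{|X_i|}. Let G = G_1 ∪ ⋯ ∪ G_t be the union graph, a bipartite graph with bipartition (X_1 ∪ ⋯ ∪ X_t, Y_1 ∪ ⋯ ∪ Y_t) whose edge set is the union of the edge sets of the G_i. Then f(G □ K_2) = |X_1 ∪ ⋯ ∪ X_t|. -/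

import Mathlib

open SimpleGraph

noncomputable def forcingNumber {V : Type*} (G : SimpleGraph V) (M : G.Subgraph) : ℕ :=
  sInf {c | ∃ S : Set (Sym2 V), S ⊆ M.edgeSet ∧ S.ncard = c ∧
    ∀ M' : G.Subgraph, M'.IsPerfectMatching → S ⊆ M'.edgeSet → M' = M}

noncomputable def minForcingNumber {V : Type*} (G : SimpleGraph V) : ℕ :=
  sInf {c | ∃ M : G.Subgraph, M.IsPerfectMatching ∧ forcingNumber G M = c}


namespace SimpleGraph.Subgraph.IsPerfectMatching

variable {W : Type*} {H : SimpleGraph W} {M M' : H.Subgraph}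

/-- The partner function of a perfect matching. -/
theorem exists_partner (hM : M.IsPerfectMatching) : ∃ m : W → W, ∀ a b, M.Adj a b ↔ m a = b := by
  choose m hm huniq using isPerfectMatching_iff.1 hM
  exact ⟨m, fun a b => ⟨fun h => (huniq a b h).symm, fun h => h ▸ hm a⟩⟩

theorem eq_of_edgeSet_subset (hM : M.IsPerfectMatching) (hM' : M'.IsPerfectMatching)
    (h : M.edgeSet ⊆ M'.edgeSet) : M' = M := by
  obtain ⟨m, hm⟩ := hM.exists_partner
  obtain ⟨m', hm'⟩ := hM'.exists_partner
  have key : ∀ a, m' a = m a := fun a => (hm' _ _).1 (h (show s(a, m a) ∈ M.edgeSet from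
    (hm a (m a)).2 rfl))
  ext a b
  · simp [hM.2 a, hM'.2 a]
  · rw [hm, hm', key]

/-- A fixed-point-free involution along the edges of a graph is a perfect matching. -/
theorem exists_of_involutive (m : W → W) (hinv : Function.Involutive m)
    (hadj : ∀ a, H.Adj a (m a)) :
    ∃ N : H.Subgraph, N.IsPerfectMatching ∧ ∀ a b, N.Adj a b ↔ m a = b := by
  refine ⟨{ verts := Set.univ
            Adj := fun a b => m a = b
            adj_sub := fun h => h ▸ hadj _
            edge_vert := fun _ => Set.mem_univ _
            symm := ⟨fun a b (h : m a = b) => h ▸ hinv a⟩ }, ?_, fun a b => Iff.rfl⟩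
  rw [isPerfectMatching_iff]
  exact fun a => ⟨m a, rfl, fun b (h : m a = b) => h.symm⟩

end SimpleGraph.Subgraph.IsPerfectMatching

/-- Every self-map of a nonempty finite set permutes some nonempty subset. -/
theorem Set.MapsTo.exists_bijOn_subset {W : Type*} [Finite W] {T : Set W} (hT : T.Nonempty)
    {φ : W → W} (hφ : Set.MapsTo φ T T) : ∃ C ⊆ T, C.Nonempty ∧ Set.BijOn φ C C := by
  have hit : ∀ n, Set.MapsTo φ^[n] T T := fun n => hφ.iterate n
  have hmaps : Set.MapsTo φ (Function.periodicPts φ ∩ T) (Function.periodicPts φ ∩ T) :=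
    fun a ha => ⟨(Function.bijOn_periodicPts φ).mapsTo ha.1, hφ ha.2⟩
  have hinj : Set.InjOn φ (Function.periodicPts φ ∩ T) :=
    (Function.bijOn_periodicPts φ).injOn.mono Set.inter_subset_left
  refine ⟨Function.periodicPts φ ∩ T, Set.inter_subset_right, ?_, 
    ((Set.toFinite _).injOn_iff_bijOn_of_mapsTo hmaps).1 hinj⟩
  obtain ⟨t, ht⟩ := hT
  obtain ⟨i, j, hij, h⟩ := Finite.exists_ne_map_eq_of_infinite (fun n : ℕ => φ^[n] t)
  wlog hlt : i < j generalizing i j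
  · exact this j i hij.symm h.symm (by omega)
  refine ⟨φ^[i] t, Function.mk_mem_periodicPts (n := j - i) (by omega) ?_, hit i ht⟩
  change φ^[j - i] (φ^[i] t) = φ^[i] t
  rw [← Function.iterate_add_apply, Nat.sub_add_cancel hlt.le]
  exact h.symm

/-- If every matching partner of a vertex of `T` has a second neighbour in `T`, then `M` can be
switched along an alternating cycle through `T`. -/
theorem SimpleGraph.Subgraph.IsPerfectMatching.exists_switch {W : Type*} [Finite W]
    {H : SimpleGraph W} {M : H.Subgraph} (hM : M.IsPerfectMatching) {T : Set W} (hT : T.Nonempty)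
    (hind : ∀ c ∈ T, ∀ r, M.Adj r c → r ∉ T)
    (hnext : ∀ c ∈ T, ∀ r, M.Adj r c → ∃ c' ∈ T, c' ≠ c ∧ H.Adj r c')
    {S : Set (Sym2 W)} (hS : S ⊆ M.edgeSet) (hST : ∀ e ∈ S, ∀ c ∈ e, c ∉ T) :
    ∃ M' : H.Subgraph, M'.IsPerfectMatching ∧ S ⊆ M'.edgeSet ∧ M' ≠ M := by
  classical
  obtain ⟨m, hm⟩ := hM.exists_partner
  have hmm : ∀ a, m (m a) = a := fun a => (hm _ _).1 ((hm a (m a)).2 rfl).symm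
  have hmadj : ∀ a, M.Adj (m a) a := fun a => (hm _ _).2 (hmm a)
  have hnext' : ∀ c, ∃ c', c ∈ T → c' ∈ T ∧ c' ≠ c ∧ H.Adj (m c) c' := by
    intro c
    by_cases hc : c ∈ T
    · obtain ⟨c', h⟩ := hnext c hc (m c) (hmadj c)
      exact ⟨c', fun _ => h⟩
    · exact ⟨c, fun h => absurd h hc⟩
  choose φ hφ using hnext'
  obtain ⟨C, hCT, ⟨c₀, hc₀⟩, hbij⟩ :=
    Set.MapsTo.exists_bijOn_subset hT (φ := φ) (fun c hc => (hφ c hc).1)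
  have : Nonempty W := ⟨c₀⟩
  set ψ := Function.invFunOn φ C
  have hψ : ∀ a ∈ C, ψ a ∈ C := fun a ha => hbij.surjOn.mapsTo_invFunOn ha
  have hφψ : ∀ a ∈ C, φ (ψ a) = a := fun a ha => hbij.invOn_invFunOn.2 ha
  have hψφ : ∀ a ∈ C, ψ (φ a) = a := fun a ha => hbij.invOn_invFunOn.1 ha
  have hmC : ∀ a ∈ C, m a ∉ C := fun a ha h => hind a (hCT ha) _ (hmadj a) (hCT h)
  let m' : W → W := fun a => if a ∈ C then m (ψ a) else if m a ∈ C then φ (m a) else m a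
  have hm'1 : ∀ a ∈ C, m' a = m (ψ a) := fun a ha => if_pos ha
  have hm'2 : ∀ a, m a ∈ C → m' a = φ (m a) := fun a ha => by
    have : a ∉ C := fun h => hmC a h ha
    simp [m', this, ha]
  have hm'3 : ∀ a, a ∉ C → m a ∉ C → m' a = m a := fun a h1 h2 => by simp [m', h1, h2]
  have hinv : Function.Involutive m' := by
    intro a
    by_cases ha : a ∈ C
    · rw [hm'1 a ha, hm'2 _ (by rw [hmm]; exact hψ a ha), hmm, hφψ a ha]
    by_cases hb : m a ∈ C
    · rw [hm'2 a hb, hm'1 _ (hbij.mapsTo hb), hψφ _ hb, hmm]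
    · rw [hm'3 a ha hb, hm'3 _ hb (by rwa [hmm]), hmm]
  have hadj : ∀ a, H.Adj a (m' a) := by
    intro a
    by_cases ha : a ∈ C
    · rw [hm'1 a ha]
      have := (hφ _ (hCT (hψ a ha))).2.2
      rw [hφψ a ha] at this
      exact this.symm
    by_cases hb : m a ∈ C
    · rw [hm'2 a hb]
      have := (hφ _ (hCT hb)).2.2
      rwa [hmm] at this
    · rw [hm'3 a ha hb]
      exact (hmadj a).symm.adj_sub
  obtain ⟨N, hN, hNadj⟩ :=
    SimpleGraph.Subgraph.IsPerfectMatching.exists_of_involutive m' hinv hadj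
  refine ⟨N, hN, ?_, ?_⟩
  · intro e he
    induction e with
    | h a b =>
      have hab : m a = b := (hm a b).1 (hS he)
      refine (hNadj a b).2 ?_
      rw [hm'3 a (fun h => hST _ he a (by simp) (hCT h))
        (fun h => hST _ he b (by simp) (hCT (hab ▸ h))), hab]
  · rintro rfl
    have h1 : m' (m c₀) = c₀ := (hNadj _ _).1 (hmadj c₀)
    rw [hm'2 _ (by rwa [hmm]), hmm] at h1
    exact (hφ c₀ (hCT hc₀)).2.1 h1

/-- If `A` and `B` are weighted bi-adjacency matrices of a bipartite graph with `A * Bᵀ` diagonal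
and invertible, every forcing set in the prism has at least `|X|` edges. -/
theorem ncard_le_of_forcing_prism {V K : Type*} [Fintype V] [DecidableEq V] [Field K]
    {G : SimpleGraph V} {X : Set V} (hG : ∀ u v, G.Adj u v → (u ∈ X ↔ v ∉ X))
    (P Q : X → V → K) (d : X → K)
    (hP : ∀ u v, P u v ≠ 0 ↔ G.Adj u v) (hQ : ∀ u v, Q u v ≠ 0 ↔ G.Adj u v)
    (hd : ∀ u, d u ≠ 0) (hPQ : ∀ u u', ∑ v, P u v * Q u' v = if u = u' then d u else 0)
    {M : (G □ (⊤ : SimpleGraph (Fin 2))).Subgraph} (hM : M.IsPerfectMatching)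
    {S : Set (Sym2 (V × Fin 2))} (hS : S ⊆ M.edgeSet)
    (hforce : ∀ M' : (G □ (⊤ : SimpleGraph (Fin 2))).Subgraph,
      M'.IsPerfectMatching → S ⊆ M'.edgeSet → M' = M) : X.ncard ≤ S.ncard := by
  classical
  by_contra! hlt
  let col : V × Fin 2 → Prop := fun p => (p.1 ∈ X ↔ p.2 = 1)
  have hcol : ∀ p q, (G □ (⊤ : SimpleGraph (Fin 2))).Adj p q → (col p ↔ ¬ col q) := by
    rintro ⟨u, i⟩ ⟨v, j⟩ h
    rw [boxProd_adj] at h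
    simp only [top_adj] at h
    simp only [col]
    rcases h with ⟨h, rfl⟩ | ⟨h, rfl⟩
    · have := hG u v h
      tauto
    · have : i = 1 ↔ j ≠ 1 := by omega
      tauto
  let w : (X → K) →ₗ[K] (V × Fin 2 → K) :=
    { toFun := fun x p => if p.2 = 0 then -∑ u : X, Q u p.1 * x u
        else if h : p.1 ∈ X then x ⟨p.1, h⟩ else 0
      map_add' := by
        intro x y
        funext p
        simp only [Pi.add_apply, mul_add, Finset.sum_add_distrib]
        split_ifs <;> ring
      map_smul' := by
        intro a x
        funext p
        simp only [Pi.smul_apply, smul_eq_mul, RingHom.id_apply]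
        split_ifs
        · rw [mul_neg, Finset.mul_sum]
          congr 1
          exact Finset.sum_congr rfl fun _ _ => by ring
        · rfl
        · simp }
  have hw0 : ∀ x v, w x (v, 0) = -∑ u : X, Q u v * x u := fun x v => by simp [w]
  have hw1 : ∀ x (u : X), w x (u, 1) = x u := fun x u => by simp [w]
  have hwcol : ∀ x p, w x p ≠ 0 → col p := by
    rintro x ⟨v, i⟩ h
    obtain rfl | rfl : i = 0 ∨ i = 1 := by omega
    · simp only [col]
      refine ⟨fun hv => absurd ?_ h, fun h => by simp at h⟩
      rw [hw0, Finset.sum_eq_zero, neg_zero]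
      intro u _
      have : Q u v = 0 := by
        by_contra hne
        exact (hG _ _ ((hQ u v).1 hne)).1 u.2 hv
      rw [this, zero_mul]
    · simp only [col]
      refine ⟨fun _ => by simp, fun _ => ?_⟩
      by_contra hv
      exact h (by simp [w, hv])
  have hrow : ∀ x r, ¬ col r → ∃ a : V × Fin 2 → K,
      (∀ c, a c ≠ 0 ↔ (G □ (⊤ : SimpleGraph (Fin 2))).Adj r c) ∧ ∑ c, a c * w x c = 0 := by
    rintro x ⟨v, i⟩ h
    obtain rfl | rfl : i = 0 ∨ i = 1 := by omega
    · have hv : v ∈ X := by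
        by_contra hv
        exact h (by simp [col, hv])
      refine ⟨fun c => if c.2 = 0 then P ⟨v, hv⟩ c.1 else if v = c.1 then d ⟨v, hv⟩ else 0, ?_, ?_⟩
      · rintro ⟨u, j⟩
        obtain rfl | rfl : j = 0 ∨ j = 1 := by omega
        · simpa [boxProd_adj] using hP ⟨v, hv⟩ u
        · simp [boxProd_adj, hd]
      · rw [Fintype.sum_prod_type]
        simp only [Fin.sum_univ_two, Finset.sum_add_distrib]
        have h2 : ∑ u, P ⟨v, hv⟩ u * w x (u, 0) = - (d ⟨v, hv⟩ * x ⟨v, hv⟩) := by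
          simp only [hw0, mul_neg, Finset.mul_sum, Finset.sum_neg_distrib]
          rw [Finset.sum_comm]
          simp only [← mul_assoc, ← Finset.sum_mul, hPQ]
          simp
        have h3 := hw1 x ⟨v, hv⟩
        simp only at h3
        simp [h2, h3]
    · have hv : v ∉ X := fun hv => h (by simp [col, hv])
      refine ⟨fun c => if c.2 = 0 then (if v = c.1 then 1 else 0)
        else if hc : c.1 ∈ X then Q ⟨c.1, hc⟩ v else 0, ?_, ?_⟩
      · rintro ⟨u, j⟩
        obtain rfl | rfl : j = 0 ∨ j = 1 := by omega
        · simp [boxProd_adj]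
        · by_cases hu : u ∈ X
          · simpa [boxProd_adj, hu, G.adj_comm v u] using hQ ⟨u, hu⟩ v
          · have : ¬ G.Adj v u := fun hadj => hv ((hG _ _ hadj).2 hu)
            simp [boxProd_adj, hu, this]
      · rw [Fintype.sum_prod_type]
        simp only [Fin.sum_univ_two, Finset.sum_add_distrib]
        have h2 : ∑ u, (if hc : u ∈ X then Q ⟨u, hc⟩ v else 0) * w x (u, 1)
            = ∑ u : X, Q u v * x u := by
          refine Finset.sum_congr_set X _ _ (fun u hu => ?_) (fun u hu => by simp [hu])
          rw [dif_pos hu, ← hw1 x ⟨u, hu⟩]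
        have h3 : ∑ u, (if v = u then 1 else 0) * w x (u, 0) = -∑ u : X, Q u v * x u := by
          simp [hw0]
        simp only [Fin.isValue, if_true, one_ne_zero, if_false]
        rw [h2, h3, neg_add_cancel]
  have hend : ∀ e : S, ∃ c, ∀ p ∈ e.1, col p → p = c := by
    rintro ⟨e, he⟩
    induction e with
    | h a b =>
      have := hcol a b (M.adj_sub (hS he))
      by_cases ha : col a
      · refine ⟨a, ?_⟩
        simp only [Sym2.mem_iff]
        rintro p (rfl | rfl) hp
        · rfl
        · exact absurd hp (this.1 ha)
      · refine ⟨b, ?_⟩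
        simp only [Sym2.mem_iff]
        rintro p (rfl | rfl) hp
        · exact absurd hp ha
        · rfl
  choose c hc using hend
  let L : (X → K) →ₗ[K] (S → K) := (LinearMap.funLeft K K c) ∘ₗ w
  have hker : LinearMap.ker L ≠ ⊥ := by
    apply LinearMap.ker_ne_bot_of_finrank_lt
    rwa [Module.finrank_fintype_fun_eq_card, Module.finrank_fintype_fun_eq_card,
      Fintype.card_eq_nat_card, Fintype.card_eq_nat_card, Nat.card_coe_set_eq,
      Nat.card_coe_set_eq]
  obtain ⟨x, hx, hx0⟩ := (Submodule.ne_bot_iff _).1 hker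
  have hxc : ∀ e, w x (c e) = 0 := fun e => congrFun (LinearMap.mem_ker.1 hx) e
  obtain ⟨M', hM', hSM', hne⟩ := hM.exists_switch (T := {p | w x p ≠ 0}) (S := S) (by
      obtain ⟨u, hu⟩ := Function.ne_iff.1 hx0
      exact ⟨(u, 1), by rw [Set.mem_ofPred_eq, hw1]; exact hu⟩)
    (fun q hq r hr hr' => (hcol r q hr.adj_sub).1 (hwcol x r hr') (hwcol x q hq))
    (by
      intro q hq r hr
      obtain ⟨a, ha, hsum⟩ := hrow x r (fun h => (hcol r q hr.adj_sub).1 h (hwcol x q hq))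
      by_contra! hno
      rw [Finset.sum_eq_single q] at hsum
      · exact (mul_ne_zero ((ha q).2 hr.adj_sub) hq) hsum
      · intro b _ hb
        by_contra hb0
        exact hno b (right_ne_zero_of_mul hb0) hb ((ha b).1 (left_ne_zero_of_mul hb0))
      · simp)
    hS (by
      intro e he p hp hpT
      have := hc ⟨e, he⟩ p hp (hwcol x p hpT)
      exact hpT (this ▸ hxc ⟨e, he⟩))
  exact hne (hforce M' hM' hSM')

/-- The fibres of the prism form a perfect matching forced by the fibres over one side. -/
theorem exists_forcing_prism {V : Type*} {G : SimpleGraph V} {X : Set V}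
    (hG : ∀ u v, G.Adj u v → (u ∈ X ↔ v ∉ X)) :
    ∃ M : (G □ (⊤ : SimpleGraph (Fin 2))).Subgraph, M.IsPerfectMatching ∧
      (fun v => s((v, (0 : Fin 2)), (v, 1))) '' X ⊆ M.edgeSet ∧
      ∀ M' : (G □ (⊤ : SimpleGraph (Fin 2))).Subgraph, M'.IsPerfectMatching →
        (fun v => s((v, (0 : Fin 2)), (v, 1))) '' X ⊆ M'.edgeSet → M' = M := by
  obtain ⟨M, hM, hadj⟩ := SimpleGraph.Subgraph.IsPerfectMatching.exists_of_involutive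
    (H := G □ (⊤ : SimpleGraph (Fin 2))) (fun p => (p.1, p.2 + 1))
    (by rintro ⟨v, i⟩; simp only [Prod.mk.injEq, true_and]; omega)
    (by rintro ⟨v, i⟩; simp [boxProd_adj])
  refine ⟨M, hM, ?_, ?_⟩
  · rintro _ ⟨v, -, rfl⟩
    exact (hadj _ _).2 rfl
  · intro M' hM' hS
    obtain ⟨m, hm⟩ := hM'.exists_partner
    have hX : ∀ v ∈ X, M'.Adj (v, 0) (v, 1) := fun v hv => hS ⟨v, hv, rfl⟩
    have key : ∀ v, M'.Adj (v, 0) (v, 1) := by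
      intro v
      by_cases hv : v ∈ X
      · exact hX v hv
      have h1 : M'.Adj (v, 0) (m (v, 0)) := (hm _ _).2 rfl
      generalize m (v, 0) = q at h1
      obtain ⟨u, j⟩ := q
      have h2 := h1.adj_sub
      rw [boxProd_adj] at h2
      simp only [top_adj] at h2
      rcases h2 with ⟨h2, rfl⟩ | ⟨h2, rfl⟩
      · have hu : u ∈ X := by
          by_contra hu
          exact hv ((hG _ _ h2).2 hu)
        have h3 := (hm _ _).1 (hX u hu)
        have h4 := (hm _ _).1 h1.symm
        simp [h3] at h4
      · obtain rfl : j = 1 := by omega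
        exact h1
    refine hM.eq_of_edgeSet_subset hM' ?_
    intro e he
    induction e with
    | h a b =>
      obtain rfl : (a.1, a.2 + 1) = b := (hadj _ _).1 he
      obtain ⟨v, i⟩ := a
      obtain rfl | rfl : i = 0 ∨ i = 1 := by omega
      · exact key v
      · exact (key v).symm

/-- Weighted bi-adjacency matrices of a union, glued from those of its parts with independent
transcendental weights so that no cancellation occurs on the diagonal. -/
theorem exists_matrices_iSup {V F : Type*} [Fintype V] [DecidableEq V] [Field F] {t : ℕ}
    (G : Fin t → SimpleGraph V) (X Y : Fin t → Set V)
    [∀ i, Fintype (X i)] [∀ i, Fintype (Y i)]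
    (hedge : ∀ i u v, (G i).Adj u v → (u ∈ X i ∧ v ∈ Y i) ∨ (u ∈ Y i ∧ v ∈ X i))
    (hYdisj : ∀ i j, i ≠ j → Disjoint (Y i) (Y j))
    (hXY : Disjoint (⋃ i, X i) (⋃ i, Y i))
    (B C : ∀ i, Matrix (X i) (Y i) F)
    (hB : ∀ i (x : X i) (y : Y i), B i x y ≠ 0 ↔ (G i).Adj x y)
    (hC : ∀ i (x : X i) (y : Y i), C i x y ≠ 0 ↔ (G i).Adj x y)
    (hBC : ∀ i, B i * (C i).transpose = 1) :
    ∃ (P Q : ↥(⋃ i, X i) → V → FractionRing (Polynomial F))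
      (d : ↥(⋃ i, X i) → FractionRing (Polynomial F)),
      (∀ u v, P u v ≠ 0 ↔ (⨆ i, G i).Adj u v) ∧ (∀ u v, Q u v ≠ 0 ↔ (⨆ i, G i).Adj u v) ∧
      (∀ u, d u ≠ 0) ∧ ∀ u u', ∑ v, P u v * Q u' v = if u = u' then d u else 0 := by
  classical
  let ι := algebraMap (Polynomial F) (FractionRing (Polynomial F))
  have hι : Function.Injective ι := IsFractionRing.injective _ _
  let E : (∀ i, Matrix (X i) (Y i) F) → Fin t → V → V → F := fun A i u v =>
    if h : u ∈ X i ∧ v ∈ Y i then A i ⟨u, h.1⟩ ⟨v, h.2⟩ else 0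
  have hEY : ∀ A i u v, E A i u v ≠ 0 → v ∈ Y i := by
    intro A i u v h
    by_contra hv
    exact h (by simp [E, hv])
  have hEadj : ∀ A : (∀ i, Matrix (X i) (Y i) F),
      (∀ i (x : X i) (y : Y i), A i x y ≠ 0 ↔ (G i).Adj x y) →
      ∀ i u v, u ∈ (⋃ i, X i) → (E A i u v ≠ 0 ↔ (G i).Adj u v) := by
    intro A hA i u v hu
    by_cases h : u ∈ X i ∧ v ∈ Y i
    · simpa [E, h] using hA i ⟨u, h.1⟩ ⟨v, h.2⟩
    · have : ¬ (G i).Adj u v := by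
        intro hadj
        rcases hedge i u v hadj with h' | h'
        · exact h h'
        · exact Set.disjoint_left.1 hXY hu (Set.mem_iUnion.2 ⟨i, h'.1⟩)
      simp [E, h, this]
  have hsum : ∀ (A : ∀ i, Matrix (X i) (Y i) F) (a : Fin t → Polynomial F),
      (∀ i, a i ≠ 0) → (∀ i (x : X i) (y : Y i), A i x y ≠ 0 ↔ (G i).Adj x y) →
      ∀ u ∈ (⋃ i, X i), ∀ v,
      (ι (∑ i, a i * Polynomial.C (E A i u v)) ≠ 0 ↔ (⨆ i, G i).Adj u v) := by
    intro A a ha hA u hu v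
    rw [map_ne_zero_iff ι hι, iSup_adj]
    constructor
    · intro h
      obtain ⟨i, -, hi⟩ := Finset.exists_ne_zero_of_sum_ne_zero h
      refine ⟨i, (hEadj A hA i u v hu).1 fun h0 => hi (by simp [h0])⟩
    · rintro ⟨i, hi⟩
      have hi' := (hEadj A hA i u v hu).2 hi
      rw [Finset.sum_eq_single i]
      · exact mul_ne_zero (ha i) (by simpa using hi')
      · intro j _ hj
        have : E A j u v = 0 := by
          by_contra h0
          exact Set.disjoint_left.1 (hYdisj j i hj) (hEY A j u v h0) (hEY A i u v hi')
        simp [this]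
      · simp
  have hprod : ∀ i u u', ∑ v, E B i u v * E C i u' v = if u = u' ∧ u ∈ X i then 1 else 0 := by
    intro i u u'
    by_cases hu : u ∈ X i
    · by_cases hu' : u' ∈ X i
      · have h1 := congrFun (congrFun (hBC i) ⟨u, hu⟩) ⟨u', hu'⟩
        rw [Matrix.mul_apply, Matrix.one_apply] at h1
        simp only [Matrix.transpose_apply, Subtype.mk.injEq] at h1
        simp only [hu, and_true]
        rw [← h1]
        convert Finset.sum_congr_set (Y i) (fun v => E B i u v * E C i u' v)
          (fun v => B i ⟨u, hu⟩ v * C i ⟨u', hu'⟩ v) (fun v hv => by simp [E, hu, hu', hv])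
          (fun v hv => by simp [E, hv])
      · have : ¬ (u = u' ∧ u ∈ X i) := fun h => hu' (h.1 ▸ h.2)
        simp [E, hu', this]
    · simp [E, hu]
  refine ⟨fun u v => ι (∑ i : Fin t, Polynomial.X ^ (i : ℕ) * Polynomial.C (E B i u v)),
    fun u v => ι (∑ i, 1 * Polynomial.C (E C i u v)),
    fun u => ι (∑ i : Fin t, if (u : V) ∈ X i then Polynomial.X ^ (i : ℕ) else 0),
    fun u v => hsum B _ (fun i => pow_ne_zero _ Polynomial.X_ne_zero) hB u u.2 v,
    fun u v => hsum C _ (fun i => one_ne_zero) hC u u.2 v, ?_, ?_⟩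
  · intro u
    rw [map_ne_zero_iff ι hι]
    obtain ⟨i, hi⟩ := Set.mem_iUnion.1 u.2
    intro h0
    have := congrArg (fun p => Polynomial.coeff p (i : ℕ)) h0
    simp only [Polynomial.finsetSum_coeff, Polynomial.coeff_zero] at this
    rw [Finset.sum_eq_single i] at this
    · simp [hi] at this
    · intro j _ hj
      have : (i : ℕ) ≠ j := fun h => hj (Fin.ext h.symm)
      split_ifs <;> simp [Polynomial.coeff_X_pow, this]
    · simp
  · intro u u'
    simp only [← map_mul, ← map_sum]
    have : ∀ v, (∑ i : Fin t, Polynomial.X ^ (i : ℕ) * Polynomial.C (E B i u v)) *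
        (∑ i, 1 * Polynomial.C (E C i u' v)) =
        ∑ i : Fin t, Polynomial.X ^ (i : ℕ) * Polynomial.C (E B i u v * E C i u' v) := by
      intro v
      rw [Finset.sum_mul]
      refine Finset.sum_congr rfl fun i _ => ?_
      rw [mul_assoc, Polynomial.C_mul]
      congr 1
      by_cases h0 : E B i u v = 0
      · simp [h0]
      rw [Finset.sum_eq_single i]
      · simp
      · intro j _ hj
        have : E C j u' v = 0 := by
          by_contra h1
          exact Set.disjoint_left.1 (hYdisj j i hj) (hEY C j u' v h1) (hEY B i u v h0)
        simp [this]
      · simp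
    simp only [this]
    rw [Finset.sum_comm]
    simp only [← Finset.mul_sum, ← map_sum, hprod]
    by_cases h : u = u'
    · simp [h]
    · have : (u : V) ≠ u' := fun h' => h (Subtype.ext h')
      simp [h, this]

open Matrix in
theorem stmt19 {V F : Type*} [Fintype V] [DecidableEq V] [Field F]
    (hchar : (2 : F) ≠ 0) (hsqrt : ∃ r : F, r * r = 2)
    (t : ℕ) (ht : 1 ≤ t)
    (G : Fin t → SimpleGraph V) (X Y : Fin t → Set V)
    [∀ i, Fintype (X i)] [∀ i, Fintype (Y i)]
    (hedge : ∀ i u v, (G i).Adj u v →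
      (u ∈ X i ∧ v ∈ Y i) ∨ (u ∈ Y i ∧ v ∈ X i))
    (hsize : ∀ i, (X i).ncard ≤ (Y i).ncard)
    (hYdisj : ∀ i j, i ≠ j → Disjoint (Y i) (Y j))
    (hXY : Disjoint (⋃ i, X i) (⋃ i, Y i))
    (B C : ∀ i, Matrix (X i) (Y i) F)
    (hB : ∀ i (x : X i) (y : Y i), B i x y ≠ 0 ↔ (G i).Adj x y)
    (hC : ∀ i (x : X i) (y : Y i), C i x y ≠ 0 ↔ (G i).Adj x y)
    (hBC : ∀ i, B i * (C i)ᵀ = 1) :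
    minForcingNumber ((⨆ i, G i) □ (⊤ : SimpleGraph (Fin 2))) = (⋃ i, X i).ncard := by
  classical
  have hG : ∀ u v, (⨆ i, G i).Adj u v → (u ∈ (⋃ i, X i) ↔ v ∉ (⋃ i, X i)) := by
    intro u v h
    obtain ⟨i, hi⟩ := iSup_adj.1 h
    rcases hedge i u v hi with ⟨hu, hv⟩ | ⟨hu, hv⟩
    · exact iff_of_true (Set.mem_iUnion_of_mem i hu)
        (Set.disjoint_right.1 hXY (Set.mem_iUnion_of_mem i hv))
    · exact iff_of_false (Set.disjoint_right.1 hXY (Set.mem_iUnion_of_mem i hu))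
        (not_not.2 (Set.mem_iUnion_of_mem i hv))
  obtain ⟨P, Q, d, hP, hQ, hd, hPQ⟩ :=
    exists_matrices_iSup G X Y hedge hYdisj hXY B C hB hC hBC
  obtain ⟨M₀, hM₀, hS₀, hforce₀⟩ := exists_forcing_prism hG
  apply le_antisymm
  · refine le_trans (Nat.sInf_le ⟨M₀, hM₀, rfl⟩) ?_
    refine le_trans (Nat.sInf_le ⟨_, hS₀, rfl, hforce₀⟩) ?_
    exact Set.ncard_image_le (Set.toFinite _)
  · refine le_csInf ⟨forcingNumber _ M₀, M₀, hM₀, rfl⟩ ?_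
    rintro _ ⟨M, hM, rfl⟩
    refine le_csInf ⟨M.edgeSet.ncard, M.edgeSet, subset_rfl, rfl, fun M' hM' h =>
      hM.eq_of_edgeSet_subset hM' h⟩ ?_
    rintro _ ⟨S, hS, rfl, hforce⟩
    exact ncard_le_of_forcing_prism hG P Q d hP hQ hd hPQ hM hS hforce
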